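/- Assume that there exists no Lusin space, i.e., no Hausdorff topological space in which every nowhere dense subset is countable, there are at most countably many isolated points, and the space is uncountable (by a theorem of Kunen this assumption follows from Suslin's Hypothesis). Let X be a Hausdorff semi-regular open Whyburn space. Then the space Q_p(X,ℝ) of quasicontinuous real-valued functions on X with the topology of pointwise convergence is Fréchet–Urysohn if and only if X is countable. -/

import Mathlib

open Set Filter Topology

section Defs

variable {X : Type*}

/-- `f : X → ℝ` is quasicontinuous: for every `x` and open sets `U ∋ x`, `V ∋ f x`
there is a nonempty open `W ⊆ U` with `f '' W ⊆ V`. -/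
def Quasicontinuous [TopologicalSpace X] (f : X → ℝ) : Prop :=
  ∀ x : X, ∀ U : Set X, IsOpen U → x ∈ U → ∀ V : Set ℝ, IsOpen V → f x ∈ V →
    ∃ W : Set X, IsOpen W ∧ W.Nonempty ∧ W ⊆ U ∧ f '' W ⊆ V

/-- `Q_p(X, ℝ)`: the quasicontinuous functions with the topology of pointwise
convergence (subspace of the product topology on `X → ℝ`). -/
abbrev Qp (X : Type*) [TopologicalSpace X] : Type _ :=
  {f : X → ℝ // Quasicontinuous f}

/-- A space is semi-regular if the regular open sets (`U = int (cl U)`) form a base. -/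
def SemiRegular (X : Type*) [TopologicalSpace X] : Prop :=
  TopologicalSpace.IsTopologicalBasis {U : Set X | U = interior (closure U)}

/-- Open Whyburn space. -/
def OpenWhyburn (X : Type*) [TopologicalSpace X] : Prop :=
  ∀ A : Set X, IsOpen A → ∀ x ∈ closure A \ A,
    ∃ B : Set X, IsOpen B ∧ B ⊆ A ∧ closure B \ A = {x}

/-- A set `A` is minimally bounded if `A ⊆ cl (int A)` and `int (cl A) ⊆ A`. -/
def MinimallyBounded [TopologicalSpace X] (A : Set X) : Prop :=
  A ⊆ closure (interior A) ∧ interior (closure A) ⊆ A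

end Defs
universe u

theorem quasicontinuous_indicator_closure {X : Type*} [TopologicalSpace X] {W : Set X}
    (hW : IsOpen W) : Quasicontinuous ((closure W).indicator (1 : X → ℝ)) := by
  intro x U hU hxU V _ hfV
  by_cases hx : x ∈ closure W
  · refine ⟨U ∩ W, hU.inter hW, mem_closure_iff.1 hx U hU hxU, inter_subset_left, ?_⟩
    rintro _ ⟨y, hy, rfl⟩
    rw [indicator_of_mem (subset_closure hy.2)]
    rwa [indicator_of_mem hx] at hfV
  · refine ⟨U ∩ (closure W)ᶜ, hU.inter isClosed_closure.isOpen_compl, ⟨x, hxU, hx⟩,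
      inter_subset_left, ?_⟩
    rintro _ ⟨y, hy, rfl⟩
    rw [indicator_of_notMem hy.2]
    rwa [indicator_of_notMem hx] at hfV

/-- If `Q_p(X, ℝ)` is Fréchet–Urysohn and every point lies in the closure of an open set whose
closure meets `P` in a countable set, then `P` is countable. -/
theorem countable_of_forall_exists_isOpen_closure_inter {X : Type*} [TopologicalSpace X]
    [FrechetUrysohnSpace (Qp X)] {P : Set X}
    (h : ∀ x, ∃ W : Set X, IsOpen W ∧ x ∈ closure W ∧ (closure W ∩ P).Countable) :
    P.Countable := by
  choose W hWo hxW hWP using h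
  let S : Set (Qp X) := {f | {p ∈ P | f.1 p ≠ 0}.Countable}
  let one : Qp X := ⟨1, by simpa using quasicontinuous_indicator_closure (X := X) isOpen_univ⟩
  have hone : one ∈ closure S := by
    let F : Finset X → Qp X := fun H =>
      ⟨(closure (⋃ x ∈ H, W x)).indicator 1,
        quasicontinuous_indicator_closure (isOpen_biUnion fun x _ => hWo x)⟩
    have hF : Tendsto F atTop (𝓝 one) := by
      refine tendsto_subtype_rng.2 (tendsto_pi_nhds.2 fun x => ?_)
      refine tendsto_const_nhds.congr' ?_
      filter_upwards [eventually_ge_atTop {x}] with H hH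
      have hx : x ∈ closure (⋃ y ∈ H, W y) :=
        closure_mono (subset_biUnion_of_mem (u := W) (hH (Finset.mem_singleton_self x))) (hxW x)
      exact (indicator_of_mem hx 1).symm
    refine mem_closure_of_tendsto hF (Eventually.of_forall fun H => ?_)
    refine (H.countable_toSet.biUnion fun x _ => hWP x).mono ?_
    rintro p ⟨hpP, hp⟩
    have hp' : p ∈ closure (⋃ x ∈ H, W x) := mem_of_indicator_ne_zero hp
    rw [H.closure_biUnion] at hp'
    simp only [mem_iUnion] at hp' ⊢
    obtain ⟨x, hx, hpx⟩ := hp'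
    exact ⟨x, hx, hpx, hpP⟩
  obtain ⟨f, hfS, hf⟩ := mem_closure_iff_seq_limit.1 hone
  refine (countable_iUnion hfS).mono fun p hp => ?_
  have hfp : Tendsto (fun n => (f n).1 p) atTop (𝓝 1) :=
    tendsto_pi_nhds.1 (tendsto_subtype_rng.1 hf) p
  obtain ⟨n, hn⟩ := (hfp.eventually_ne one_ne_zero).exists
  exact mem_iUnion.2 ⟨n, hp, hn⟩

theorem OpenWhyburn.countable_of_isNowhereDense {X : Type*} [TopologicalSpace X] [T1Space X]
    (hw : OpenWhyburn X) [FrechetUrysohnSpace (Qp X)] {A : Set X} (hA : IsNowhereDense A) :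
    A.Countable := by
  refine (countable_of_forall_exists_isOpen_closure_inter (P := closure A) fun x => ?_).mono
    subset_closure
  by_cases hx : IsOpen ({x} : Set X)
  · refine ⟨{x}, hx, by simp, ?_⟩
    rw [closure_singleton]
    exact (countable_singleton x).mono inter_subset_left
  · have hd : Dense ((closure A)ᶜ ∩ {x}ᶜ) :=
      (interior_eq_empty_iff_dense_compl.1 hA).inter_of_isOpen_left
        (dense_compl_singleton_iff_not_open.2 hx) isClosed_closure.isOpen_compl
    obtain ⟨B, hBo, -, hB⟩ := hw _ (isClosed_closure.isOpen_compl.inter isOpen_compl_singleton) x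
      ⟨hd x, by simp⟩
    have hxB : x ∈ closure B \ ((closure A)ᶜ ∩ {x}ᶜ) :=
      hB.symm.subset (mem_singleton x)
    refine ⟨B, hBo, hxB.1, (countable_singleton x).mono ?_⟩
    rw [← hB]
    exact fun y hy => ⟨hy.1, fun h => h.1 hy.2⟩

theorem isOpen_of_forall_isOpen_singleton {X : Type*} [TopologicalSpace X] {s : Set X}
    (hs : ∀ y ∈ s, IsOpen ({y} : Set X)) : IsOpen s := by
  rw [← biUnion_of_singleton s]
  exact isOpen_biUnion hs

/-- A set of isolated points with at most one accumulation point `x` is countable whenever `x`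
is also an accumulation point of a disjoint open set and `Q_p(X, ℝ)` is Fréchet–Urysohn. -/
theorem countable_of_isolated_of_closure_subset_insert {X : Type*} [TopologicalSpace X] [T1Space X]
    [FrechetUrysohnSpace (Qp X)] {P Z : Set X} {x : X}
    (hP : ∀ y ∈ P, IsOpen ({y} : Set X)) (hPx : closure P ⊆ insert x P) (hZ : IsOpen Z)
    (hPZ : Disjoint P Z) (hx : x ∈ closure P → x ∈ closure Z) : P.Countable := by
  have hPo : IsOpen P := isOpen_of_forall_isOpen_singleton hP
  refine countable_of_forall_exists_isOpen_closure_inter fun y => ?_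
  by_cases hyP : y ∈ P
  · refine ⟨{y}, hP y hyP, by simp, ?_⟩
    rw [closure_singleton]
    exact (countable_singleton y).mono inter_subset_left
  by_cases hy : y ∈ closure P
  · obtain rfl : y = x := (hPx hy).resolve_right hyP
    refine ⟨Z, hZ, hx hy, ?_⟩
    rw [(hPZ.symm.closure_left hPo).inter_eq]
    exact countable_empty
  · refine ⟨(closure P)ᶜ, isClosed_closure.isOpen_compl, subset_closure hy, ?_⟩
    have hd : Disjoint (closure P)ᶜ P := disjoint_compl_left.mono_right subset_closure
    rw [(hd.closure_left hPo).inter_eq]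
    exact countable_empty

theorem OpenWhyburn.countable_setOf_isOpen_singleton {X : Type*} [TopologicalSpace X] [T1Space X]
    (hw : OpenWhyburn X) [FrechetUrysohnSpace (Qp X)] :
    {y : X | IsOpen ({y} : Set X)}.Countable := by
  set D := {y : X | IsOpen ({y} : Set X)} with hD
  have hDo : IsOpen D := isOpen_of_forall_isOpen_singleton fun y hy => hy
  by_cases hcount : ∀ x ∈ closure D \ D, ∀ B : Set X, IsOpen B → B ⊆ D → closure B \ D = {x} →
      B.Countable
  · refine countable_of_forall_exists_isOpen_closure_inter fun x => ?_
    by_cases hxD : x ∈ D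
    · refine ⟨{x}, hxD, by simp, ?_⟩
      rw [closure_singleton]
      exact (countable_singleton x).mono inter_subset_left
    by_cases hx : x ∈ closure D
    · obtain ⟨B, hBo, hBD, hB⟩ := hw D hDo x ⟨hx, hxD⟩
      have hxB : x ∈ closure B \ D := hB.symm.subset (mem_singleton x)
      refine ⟨B, hBo, hxB.1, (hcount x ⟨hx, hxD⟩ B hBo hBD hB).mono ?_⟩
      rintro y ⟨hyB, hyD⟩
      obtain ⟨z, rfl, hz⟩ := mem_closure_iff.1 hyB {y} hyD rfl
      exact hz
    · refine ⟨(closure D)ᶜ, isClosed_closure.isOpen_compl, subset_closure hx, ?_⟩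
      have hd : Disjoint (closure D)ᶜ D := disjoint_compl_left.mono_right subset_closure
      rw [(hd.closure_left hDo).inter_eq]
      exact countable_empty
  · push Not at hcount
    obtain ⟨x, -, B, -, hBD, hB, hBc⟩ := hcount
    exfalso
    have hsub : ∀ s ⊆ B, closure s ⊆ insert x s := by
      intro s hs y hy
      by_cases hyD : y ∈ D
      · obtain ⟨z, rfl, hz⟩ := mem_closure_iff.1 hy {y} hyD rfl
        exact Or.inr hz
      · exact Or.inl (hB ▸ ⟨closure_mono hs hy, hyD⟩ : y ∈ ({x} : Set X))
    have hBinf : B.Infinite := fun h => hBc h.countable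
    obtain ⟨P, Z, hPZ, hdisj, hcard⟩ := hBinf.exists_union_disjoint_cardinal_eq_of_infinite
    have hPB : P ⊆ B := hPZ ▸ subset_union_left
    have hZB : Z ⊆ B := hPZ ▸ subset_union_right
    have hiso : ∀ s ⊆ B, ∀ y ∈ s, IsOpen ({y} : Set X) := fun s hs y hy => hBD (hs hy)
    have hiff : P.Countable ↔ Z.Countable := by
      rw [← Cardinal.le_aleph0_iff_set_countable, hcard, Cardinal.le_aleph0_iff_set_countable]
    have hPc : P.Countable := by
      by_cases hx : x ∈ closure P
      · exact hiff.2 <| countable_of_isolated_of_closure_subset_insert (hiso Z hZB) (hsub Z hZB)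
          (isOpen_of_forall_isOpen_singleton (hiso P hPB)) hdisj.symm fun _ => hx
      · exact countable_of_isolated_of_closure_subset_insert (hiso P hPB) (hsub P hPB)
          (isOpen_of_forall_isOpen_singleton (hiso Z hZB)) hdisj fun h => absurd h hx
    exact hBc (hPZ ▸ hPc.union (hiff.1 hPc))

theorem qp_frechetUrysohn_iff_countable_of_noLusin
    (X : Type u) [TopologicalSpace X] [T2Space X] (hsr : SemiRegular X)
    (hw : OpenWhyburn X)
    (hNoLusin : ∀ (Y : Type u) (_ : TopologicalSpace Y) (_ : T2Space Y),
      ¬((∀ A : Set Y, IsNowhereDense A → A.Countable) ∧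
        ({y : Y | IsOpen ({y} : Set Y)}).Countable ∧ Uncountable Y)) :
    FrechetUrysohnSpace (Qp X) ↔ Countable X := by
  refine ⟨fun _ => ?_, fun _ => inferInstance⟩
  by_contra hX
  exact hNoLusin X _ ‹_› ⟨fun _ hA => hw.countable_of_isNowhereDense hA,
    hw.countable_setOf_isOpen_singleton, not_countable_iff.1 hX⟩
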